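/- Under the stated setup, the tangent distance estimate satisfies the Euclidean-norm bound ‖λ_e − λ_o‖ ≤ d · K · η_min(G(λ_r))⁻¹ · ( (1/2)·√(tr(G(λ_r)))·‖λ_o − λ_r‖² + ν · ‖λ_o − λ_r‖ ). -/

import Mathlib

open scoped RealInnerProductSpace BigOperators

/-- The `i`-th partial derivative `∂ᵢp(x) ∈ H` of a map `p : ℝᵈ → H`. -/
noncomputable def pderiv {H : Type*} [NormedAddCommGroup H] [NormedSpace ℝ H] {d : ℕ}
    (p : EuclideanSpace ℝ (Fin d) → H) (i : Fin d) (x : EuclideanSpace ℝ (Fin d)) : H :=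
  fderiv ℝ p x (EuclideanSpace.single i 1)

/-- The second partial derivative `∂ᵢⱼp(x) ∈ H`. -/
noncomputable def pderiv2 {H : Type*} [NormedAddCommGroup H] [NormedSpace ℝ H] {d : ℕ}
    (p : EuclideanSpace ℝ (Fin d) → H) (i j : Fin d) (x : EuclideanSpace ℝ (Fin d)) : H :=
  fderiv ℝ (fun y => pderiv p j y) x (EuclideanSpace.single i 1)

/-- The Gram (metric) matrix `G(x)ᵢⱼ = ⟨∂ᵢp(x), ∂ⱼp(x)⟩`. -/
noncomputable def gram {H : Type*} [NormedAddCommGroup H] [InnerProductSpace ℝ H] {d : ℕ}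
    (p : EuclideanSpace ℝ (Fin d) → H) (x : EuclideanSpace ℝ (Fin d)) :
    Matrix (Fin d) (Fin d) ℝ :=
  Matrix.of fun i j => ⟪pderiv p i x, pderiv p j x⟫

/-- Smallest eigenvalue of a symmetric real matrix. -/
noncomputable def etaMin {d : ℕ} (A : Matrix (Fin d) (Fin d) ℝ) : ℝ :=
  if h : A.IsHermitian then ⨅ i, h.eigenvalues i else 0


/-- The `ℓ¹` norm on `ℝᵈ` is at most `√d` times the Euclidean norm. -/
theorem EuclideanSpace.sum_abs_le_sqrt_mul_norm {d : ℕ} (v : EuclideanSpace ℝ (Fin d)) :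
    ∑ i, |v i| ≤ √d * ‖v‖ := by
  rw [EuclideanSpace.norm_eq, ← Real.sqrt_mul (Nat.cast_nonneg d)]
  apply Real.le_sqrt_of_sq_le
  simpa using sq_sum_le_card_mul_sum_sq (s := Finset.univ) (f := fun i => |v i|)

theorem EuclideanSpace.map_eq_sum_single {F : Type*} [NormedAddCommGroup F] [NormedSpace ℝ F]
    {d : ℕ} (L : EuclideanSpace ℝ (Fin d) →L[ℝ] F) (v : EuclideanSpace ℝ (Fin d)) :
    L v = ∑ i, v i • L (EuclideanSpace.single i 1) := by
  conv_lhs => rw [← (EuclideanSpace.basisFun (Fin d) ℝ).sum_repr v]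
  simp

/-- The smallest eigenvalue bounds the quadratic form from below. -/
theorem etaMin_mul_norm_sq_le {d : ℕ} {A : Matrix (Fin d) (Fin d) ℝ} (hA : A.IsHermitian)
    (v : EuclideanSpace ℝ (Fin d)) :
    etaMin A * ‖v‖ ^ 2 ≤ v.ofLp ⬝ᵥ A.mulVec v.ofLp := by
  have hcoord (i : Fin d) : ⟪hA.eigenvectorBasis i, WithLp.toLp 2 (A.mulVec v.ofLp)⟫ =
      hA.eigenvalues i * ⟪hA.eigenvectorBasis i, v⟫ := by
    have hT : A.transpose = A := by simpa using hA.eq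
    have h1 : (hA.eigenvectorBasis i).ofLp ⬝ᵥ A.mulVec v.ofLp =
        hA.eigenvalues i * ((hA.eigenvectorBasis i).ofLp ⬝ᵥ v.ofLp) := by
      rw [Matrix.dotProduct_mulVec, ← Matrix.mulVec_transpose, hT, hA.mulVec_eigenvectorBasis,
        smul_dotProduct, smul_eq_mul]
    simpa [EuclideanSpace.inner_eq_star_dotProduct, dotProduct_comm] using h1
  have hquad : v.ofLp ⬝ᵥ A.mulVec v.ofLp =
      ∑ i, hA.eigenvalues i * ‖⟪hA.eigenvectorBasis i, v⟫‖ ^ 2 := by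
    have h := hA.eigenvectorBasis.sum_inner_mul_inner v (WithLp.toLp 2 (A.mulVec v.ofLp))
    have h2 : ⟪v, WithLp.toLp 2 (A.mulVec v.ofLp)⟫ = v.ofLp ⬝ᵥ A.mulVec v.ofLp := by
      simp [EuclideanSpace.inner_eq_star_dotProduct, dotProduct_comm]
    rw [← h2, ← h]
    refine Finset.sum_congr rfl fun i _ => ?_
    rw [hcoord, real_inner_comm, Real.norm_eq_abs, sq_abs]
    ring
  rw [hquad, ← hA.eigenvectorBasis.sum_sq_norm_inner_right v, Finset.mul_sum, etaMin, dif_pos hA]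
  gcongr with i
  exact ciInf_le (Finite.bddBelow_range _) i

theorem etaMin_pos {d : ℕ} (hd : 0 < d) {A : Matrix (Fin d) (Fin d) ℝ} (hA : A.PosDef) :
    0 < etaMin A := by
  have : Nonempty (Fin d) := ⟨⟨0, hd⟩⟩
  rw [etaMin, dif_pos hA.1]
  obtain ⟨i, hi⟩ := exists_eq_ciInf_of_finite (f := hA.1.eigenvalues)
  rw [← hi]
  exact hA.eigenvalues_pos i

section

variable {H : Type*} [NormedAddCommGroup H] [InnerProductSpace ℝ H] {d : ℕ}
  {p : EuclideanSpace ℝ (Fin d) → H}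

theorem gram_mulVec (x v : EuclideanSpace ℝ (Fin d)) (j : Fin d) :
    (gram p x).mulVec v.ofLp j = ⟪fderiv ℝ p x v, pderiv p j x⟫ := by
  rw [EuclideanSpace.map_eq_sum_single, sum_inner, Matrix.mulVec, dotProduct]
  refine Finset.sum_congr rfl fun i _ => ?_
  rw [real_inner_smul_left, gram, Matrix.of_apply, real_inner_comm, mul_comm]
  rfl

theorem dotProduct_gram_mulVec (x v w : EuclideanSpace ℝ (Fin d)) :
    w.ofLp ⬝ᵥ (gram p x).mulVec v.ofLp = ⟪fderiv ℝ p x v, fderiv ℝ p x w⟫ := by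
  rw [EuclideanSpace.map_eq_sum_single _ w, inner_sum, dotProduct]
  refine Finset.sum_congr rfl fun i _ => ?_
  rw [real_inner_smul_right, gram_mulVec]
  rfl

theorem norm_fderiv_apply_le_sqrt_trace_gram (x v : EuclideanSpace ℝ (Fin d)) :
    ‖fderiv ℝ p x v‖ ≤ √(gram p x).trace * ‖v‖ := by
  have htr : (gram p x).trace = ∑ i, ‖pderiv p i x‖ ^ 2 := by
    simp [Matrix.trace, gram]
  rw [EuclideanSpace.map_eq_sum_single, htr, EuclideanSpace.norm_eq]
  calc ‖∑ i, v i • pderiv p i x‖ ≤ ∑ i, ‖v i • pderiv p i x‖ := norm_sum_le _ _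
    _ = ∑ i, ‖pderiv p i x‖ * ‖v i‖ := by simp [norm_smul, mul_comm]
    _ ≤ _ := Real.sum_mul_le_sqrt_mul_sqrt _ _ _

/-- A uniform bound on the second partial derivatives bounds the operator norm of the second
derivative. -/
theorem norm_fderiv_fderiv_le (hp : ContDiff ℝ 2 p) {K : ℝ} (hK : 0 ≤ K)
    {x : EuclideanSpace ℝ (Fin d)} (hKb : ∀ i j, ‖pderiv2 p i j x‖ ≤ K) :
    ‖fderiv ℝ (fderiv ℝ p) x‖ ≤ d * K := by
  have hdiff : DifferentiableAt ℝ (fderiv ℝ p) x :=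
    (hp.fderiv_right (m := 1) (by norm_num)).differentiable (by norm_num) x
  have hent (i j : Fin d) : fderiv ℝ (fderiv ℝ p) x (EuclideanSpace.single i 1)
      (EuclideanSpace.single j 1) = pderiv2 p i j x := by
    unfold pderiv2 pderiv
    rw [fderiv_clm_apply hdiff (differentiableAt_const _)]
    simp
  refine ContinuousLinearMap.opNorm_le_bound₂ _ (by positivity) fun v w => ?_
  have hexp : fderiv ℝ (fderiv ℝ p) x v w = ∑ j, ∑ i, (w j * v i) • pderiv2 p i j x := by
    rw [EuclideanSpace.map_eq_sum_single (fderiv ℝ (fderiv ℝ p) x v) w]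
    refine Finset.sum_congr rfl fun j _ => ?_
    rw [EuclideanSpace.map_eq_sum_single (fderiv ℝ (fderiv ℝ p) x) v, sum_apply,
      Finset.smul_sum]
    simp [hent, smul_smul]
  calc ‖fderiv ℝ (fderiv ℝ p) x v w‖ ≤ ∑ j, ∑ i, |w j| * |v i| * K := by
        rw [hexp]
        refine (norm_sum_le _ _).trans (Finset.sum_le_sum fun j _ => ?_)
        refine (norm_sum_le _ _).trans (Finset.sum_le_sum fun i _ => ?_)
        rw [norm_smul, norm_mul, Real.norm_eq_abs, Real.norm_eq_abs]
        gcongr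
        exact hKb i j
    _ = (∑ j, |w j|) * (∑ i, |v i|) * K := by
        rw [Finset.sum_mul_sum, Finset.sum_mul]
        simp_rw [Finset.sum_mul]
    _ ≤ (√d * ‖w‖) * (√d * ‖v‖) * K := by
        gcongr <;> exact EuclideanSpace.sum_abs_le_sqrt_mul_norm _
    _ = d * K * ‖v‖ * ‖w‖ := by
        have h := Real.mul_self_sqrt (Nat.cast_nonneg (α := ℝ) d)
        linear_combination (‖w‖ * ‖v‖ * K) * h

end

/-- First-order Taylor estimate for a map with Lipschitz derivative. -/
theorem norm_sub_sub_fderiv_le {E F : Type*} [NormedAddCommGroup E] [NormedSpace ℝ E]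
    [NormedAddCommGroup F] [NormedSpace ℝ F] {f : E → F} (hf : Differentiable ℝ f) {M : ℝ} {x : E}
    (hM : ∀ y, ‖fderiv ℝ f y - fderiv ℝ f x‖ ≤ M * ‖y - x‖) (y : E) :
    ‖f y - f x - fderiv ℝ f x (y - x)‖ ≤ 1 / 2 * M * ‖y - x‖ ^ 2 := by
  set u := y - x with hu
  have hder (t : ℝ) : HasDerivAt (fun t : ℝ => f (x + t • u) - f x - t • fderiv ℝ f x u)
      (fderiv ℝ f (x + t • u) u - fderiv ℝ f x u) t := by
    have hline : HasDerivAt (fun t : ℝ => x + t • u) u t := by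
      simpa using ((hasDerivAt_id t).smul_const u).const_add x
    have hlin : HasDerivAt (fun t : ℝ => t • fderiv ℝ f x u) (fderiv ℝ f x u) t := by
      simpa using (hasDerivAt_id t).smul_const (fderiv ℝ f x u)
    exact (((hf _).hasFDerivAt.comp_hasDerivAt t hline).sub_const _).sub hlin
  have hB (t : ℝ) : HasDerivAt (fun t : ℝ => 1 / 2 * M * ‖u‖ ^ 2 * t ^ 2) (M * ‖u‖ ^ 2 * t) t := by
    refine ((hasDerivAt_pow 2 t).const_mul (1 / 2 * M * ‖u‖ ^ 2)).congr_deriv ?_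
    push_cast
    ring
  have h := image_norm_le_of_norm_deriv_right_le_deriv_boundary (a := 0) (b := 1)
    (fun t _ => (hder t).continuousAt.continuousWithinAt)
    (fun t _ => (hder t).hasDerivWithinAt) (by simp) hB
    (fun t ht => by
      rw [← sub_apply]
      refine (ContinuousLinearMap.le_opNorm _ _).trans ?_
      have h1 := hM (x + t • u)
      rw [add_sub_cancel_left, norm_smul, Real.norm_of_nonneg ht.1] at h1
      nlinarith [norm_nonneg u])
    (Set.right_mem_Icc.2 zero_le_one)
  simpa [hu] using h

/-- Euclidean-norm version of the tangent distance alignment error bound. -/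
theorem tangent_distance_alignment_error_bound_euclidean
    {H : Type*} [NormedAddCommGroup H] [InnerProductSpace ℝ H]
    {d : ℕ} (hd : 0 < d)
    (p : EuclideanSpace ℝ (Fin d) → H) (hp : ContDiff ℝ 2 p)
    (K : ℝ) (hK : 0 ≤ K)
    (hKb : ∀ (x : EuclideanSpace ℝ (Fin d)) (i j : Fin d), ‖pderiv2 p i j x‖ ≤ K)
    (lr lo : EuclideanSpace ℝ (Fin d))
    (hPD : (gram p lr).PosDef)
    (n : H) (hn : ∀ i, ⟪n, pderiv p i lo⟫ = 0)
    (ν : ℝ) (hν : ν = ‖n‖)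
    (q : H) (hq : q = p lo + n)
    (lE : EuclideanSpace ℝ (Fin d))
    (hlE : ∀ i, lE i = lr i + ∑ j, (gram p lr)⁻¹ i j * ⟪q - p lr, pderiv p j lr⟫) :
    ‖lE - lo‖ ≤ (d : ℝ) * K * (etaMin (gram p lr))⁻¹ *
      (1 / 2 * Real.sqrt (gram p lr).trace * ‖lo - lr‖ ^ 2 + ν * ‖lo - lr‖) := by
  have hdp : Differentiable ℝ p := hp.differentiable (by norm_num)
  have hdp' : Differentiable ℝ (fderiv ℝ p) :=
    (hp.fderiv_right (m := 1) (by norm_num)).differentiable (by norm_num)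
  have hLip (x y : EuclideanSpace ℝ (Fin d)) :
      ‖fderiv ℝ p y - fderiv ℝ p x‖ ≤ d * K * ‖y - x‖ :=
    convex_univ.norm_image_sub_le_of_norm_fderiv_le (fun z _ => hdp' z)
      (fun z _ => norm_fderiv_fderiv_le hp hK (hKb z)) (Set.mem_univ x) (Set.mem_univ y)
  have hTaylor := norm_sub_sub_fderiv_le hdp (hLip lr) lo
  have hη := etaMin_pos hd hPD
  set G := gram p lr with hG
  set v := lE - lo with hv
  set u := lo - lr with hu
  set L := fderiv ℝ p lr with hL
  have hsolve : G.mulVec (lE - lr).ofLp = fun j => ⟪q - p lr, pderiv p j lr⟫ := by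
    have h : (lE - lr).ofLp = G⁻¹.mulVec fun j => ⟪q - p lr, pderiv p j lr⟫ := by
      ext i
      simp [hlE i, Matrix.mulVec, dotProduct]
    rw [h, Matrix.mulVec_mulVec, Matrix.mul_nonsing_inv _ hPD.det_pos.ne'.isUnit,
      Matrix.one_mulVec]
  have hnormal : ⟪L (lE - lr), L v⟫ = ⟪q - p lr, L v⟫ := by
    rw [hL, ← dotProduct_gram_mulVec, ← hG, hsolve, EuclideanSpace.map_eq_sum_single _ v, inner_sum]
    simp [dotProduct, real_inner_smul_right, pderiv]
  have hn0 : ⟪n, fderiv ℝ p lo v⟫ = 0 := by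
    rw [EuclideanSpace.map_eq_sum_single, inner_sum]
    refine Finset.sum_eq_zero fun i _ => ?_
    rw [real_inner_smul_right]
    exact mul_eq_zero_of_right _ (hn i)
  have hquad : ⟪L v, L v⟫ =
      ⟪p lo - p lr - L u, L v⟫ - ⟪n, (fderiv ℝ p lo - L) v⟫ := by
    have hLv : L v = L (lE - lr) - L u := by rw [← map_sub, hv, hu]; congr 1; abel
    have hq' : q - p lr = (p lo - p lr) + n := by rw [hq]; abel
    have h1 : ⟪L v, L v⟫ = ⟪L (lE - lr), L v⟫ - ⟪L u, L v⟫ := by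
      rw [← inner_sub_left, ← hLv]
    rw [h1, hnormal, hq', inner_add_left, inner_sub_left (p lo - p lr), sub_apply,
      inner_sub_right, hn0]
    ring
  have hlow : etaMin G * ‖v‖ ^ 2 ≤ ⟪L v, L v⟫ := by
    rw [hL, ← dotProduct_gram_mulVec]
    exact etaMin_mul_norm_sq_le hPD.1 v
  have hR : ⟪p lo - p lr - L u, L v⟫ ≤ 1 / 2 * (d * K) * ‖u‖ ^ 2 * (√G.trace * ‖v‖) :=
    (real_inner_le_norm _ _).trans (mul_le_mul hTaylor
      (norm_fderiv_apply_le_sqrt_trace_gram lr v) (norm_nonneg _) (by positivity))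
  have hN : -⟪n, (fderiv ℝ p lo - L) v⟫ ≤ ν * (d * K * ‖u‖ * ‖v‖) := by
    refine (neg_le_abs _).trans ((abs_real_inner_le_norm _ _).trans ?_)
    rw [hν]
    gcongr
    exact ContinuousLinearMap.le_of_opNorm_le _ (hLip lr lo) v
  have hmain : etaMin G * ‖v‖ ≤ d * K * (1 / 2 * √G.trace * ‖u‖ ^ 2 + ν * ‖u‖) := by
    rcases (norm_nonneg v).eq_or_lt with h0 | h0
    · rw [← h0, mul_zero, hν]
      positivity
    · refine le_of_mul_le_mul_right ?_ h0
      linarith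
  calc ‖v‖ = (etaMin G)⁻¹ * (etaMin G * ‖v‖) := (inv_mul_cancel_left₀ hη.ne' _).symm
    _ ≤ (etaMin G)⁻¹ * (d * K * (1 / 2 * √G.trace * ‖u‖ ^ 2 + ν * ‖u‖)) := by gcongr
    _ = _ := by ring
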